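/- Let V be a vector space over a field k of characteristic zero. Then the associated graded Poisson algebra ⊕_{n≥0} F_n T V / F_{n+1} T V of the tensor algebra T V with respect to its commutator filtration is isomorphic to the free Poisson algebra S(L V), via the natural map sending the class of a bracket-degree-n element to its symbol. -/

import Mathlib

/-- A Poisson bracket on a commutative `k`-algebra `P`: a bilinear Lie bracket
satisfying the Leibniz rule `{a, bc} = {a,b}c + b{a,c}`. -/
structure PoissonStructure (k : Type) [Field k]
    (P : Type) [CommRing P] [Algebra k P] : Type where
  bracket : P →ₗ[k] P →ₗ[k] P
  bracket_self : ∀ a : P, bracket a a = 0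
  jacobi : ∀ a b c : P,
    bracket a (bracket b c) = bracket (bracket a b) c + bracket b (bracket a c)
  leibniz : ∀ a b c : P, bracket a (b * c) = bracket a b * c + b * bracket a c

open Submodule

variable (k : Type) [Field k] [CharZero k]
variable (R : Type) [Ring R] [Algebra k R]

/-- The two-sided ideal (as a `k`-submodule) generated by a set. -/
def idealGen (S : Set R) : Submodule k R :=
  Submodule.span k {x | ∃ a s b, s ∈ S ∧ x = a * s * b}

/-- The set of commutators of elements of two submodules. -/
def brIdeal (M N : Submodule k R) : Submodule k R :=
  idealGen k R {x | ∃ m ∈ M, ∃ n ∈ N, x = m * n - n * m}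

/-- The commutator filtration of `R`:
`F 0 = R`, `F (n+1) = Σ_{p=1}^n F p * F (n+1-p) + Σ_{p=0}^n ⟨[F p, F (n-p)]⟩`. -/
def commFilt : ℕ → Submodule k R
  | 0 => ⊤
  | n + 1 =>
      ((Finset.Icc 1 n).attach.sum fun p =>
          commFilt p.1 * commFilt (n + 1 - p.1)) +
      ((Finset.range (n + 1)).attach.sum fun p =>
          brIdeal k R (commFilt p.1) (commFilt (n - p.1)))
  decreasing_by
  · have := Finset.mem_Icc.mp p.2; omega
  · have := Finset.mem_Icc.mp p.2; omega
  · have := Finset.mem_range.mp p.2; omega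
  · have := Finset.mem_range.mp p.2; omega

variable (V : Type) [AddCommGroup V] [Module k V]

/-- Abbreviation for `F_n T V / F_{n+1} T V`. -/
abbrev grTV (n : ℕ) :=
  ↥(commFilt k (TensorAlgebra k V) n) ⧸
    (Submodule.comap (commFilt k (TensorAlgebra k V) n).subtype
      (commFilt k (TensorAlgebra k V) (n + 1)))

variable (P : Type) [CommRing P] [Algebra k P]

/-- The bracket-degree-`d` piece of the free Poisson algebra on `V` with generator
map `ιP`: `B 0 = V`, `B (d+1) = span {ιP V, B d}`. -/
def pGrade (pb : PoissonStructure k P) (ιP : V →ₗ[k] P) : ℕ → Submodule k P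
  | 0 => LinearMap.range ιP
  | d + 1 => Submodule.span k
      {z | ∃ x ∈ LinearMap.range ιP, ∃ y ∈ pGrade pb ιP d, z = pb.bracket x y}

/-- The degree-`n` homogeneous part of the free Poisson algebra: the span of products
of graded pieces of total degree `n`. -/
def pHomog (pb : PoissonStructure k P) (ιP : V →ₗ[k] P) (n : ℕ) : Submodule k P :=
  ⨆ (l : List ℕ) (_ : l.sum = n), (l.map fun d => pGrade k V P pb ιP d).prod

section Helpers

set_option linter.unusedSectionVars false

/-! ### The commutator filtration -/

theorem commFilt_zero' : commFilt k R 0 = ⊤ := by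
  rw [commFilt]

theorem commFilt_succ' (n : ℕ) : commFilt k R (n + 1) =
    ((Finset.Icc 1 n).sum fun p => commFilt k R p * commFilt k R (n + 1 - p)) +
      ((Finset.range (n + 1)).sum fun p =>
        brIdeal k R (commFilt k R p) (commFilt k R (n - p))) := by
  rw [commFilt]
  rw [Finset.sum_attach (Finset.Icc 1 n)
    (fun p => commFilt k R p * commFilt k R (n + 1 - p)),
    Finset.sum_attach (Finset.range (n + 1))
    (fun p => brIdeal k R (commFilt k R p) (commFilt k R (n - p)))]

theorem finset_sum_submodule_le {M : Type} [AddCommGroup M] [Module k M]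
    (s : Finset ℕ) (f : ℕ → Submodule k M) (G : Submodule k M) (h : ∀ p ∈ s, f p ≤ G) :
    s.sum f ≤ G := by
  induction s using Finset.cons_induction with
  | empty => simp
  | cons a s ha ih =>
    rw [Finset.sum_cons, Submodule.add_eq_sup]
    exact sup_le (h _ (by simp)) (ih fun p hp => h p (by simp [hp]))

theorem le_finset_sum_submodule {M : Type} [AddCommGroup M] [Module k M]
    (s : Finset ℕ) (f : ℕ → Submodule k M) (p : ℕ) (hp : p ∈ s) :
    f p ≤ s.sum f := by
  rw [← Finset.add_sum_erase s f hp, Submodule.add_eq_sup]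
  exact le_sup_left

/-- The commutator filtration is the smallest multiplicative filtration with the
commutator property. -/
theorem commFilt_le (G : ℕ → Submodule k R) (h0 : ∀ x, x ∈ G 0)
    (hmul : ∀ p q x y, x ∈ G p → y ∈ G q → x * y ∈ G (p + q))
    (hcomm : ∀ p q x y, x ∈ G p → y ∈ G q → x * y - y * x ∈ G (p + q + 1)) (n : ℕ) :
    commFilt k R n ≤ G n := by
  induction n using Nat.strong_induction_on with
  | _ n ih =>
    cases n with
    | zero => intro x _; exact h0 x
    | succ n =>
      rw [commFilt_succ', Submodule.add_eq_sup]
      refine sup_le (finset_sum_submodule_le k _ _ _ fun p hp => ?_)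
        (finset_sum_submodule_le k _ _ _ fun p hp => ?_)
      · rw [Finset.mem_Icc] at hp
        rw [Submodule.mul_le]
        intro x hx y hy
        have := hmul _ _ x y (ih p (by omega) hx) (ih (n + 1 - p) (by omega) hy)
        rwa [show p + (n + 1 - p) = n + 1 by omega] at this
      · rw [Finset.mem_range] at hp
        rw [brIdeal, idealGen, Submodule.span_le]
        rintro _ ⟨a, s, b, ⟨x, hx, y, hy, rfl⟩, rfl⟩
        have h1 := hcomm _ _ x y (ih p (by omega) hx) (ih (n - p) (by omega) hy)
        rw [show p + (n - p) + 1 = n + 1 by omega] at h1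
        have h2 := hmul _ _ _ _ (hmul 0 _ _ _ (h0 a) h1) (h0 b)
        rwa [Nat.zero_add, Nat.add_zero] at h2

theorem commFilt_comm (p q : ℕ) (x y : R) (hx : x ∈ commFilt k R p)
    (hy : y ∈ commFilt k R q) : x * y - y * x ∈ commFilt k R (p + q + 1) := by
  rw [commFilt_succ', Submodule.add_eq_sup]
  refine Submodule.mem_sup_right (le_finset_sum_submodule k _ _ p (by simp) ?_)
  refine Submodule.subset_span ⟨1, _, 1, ⟨x, hx, y, ?_, rfl⟩, by simp⟩
  rwa [Nat.add_sub_cancel_left]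

theorem brIdeal_ideal (M N : Submodule k R) (a b x : R) (hx : x ∈ brIdeal k R M N) :
    a * x * b ∈ brIdeal k R M N := by
  rw [brIdeal, idealGen] at hx ⊢
  induction hx using Submodule.span_induction with
  | mem x hx =>
    obtain ⟨a', s, b', hs, rfl⟩ := hx
    exact Submodule.subset_span ⟨a * a', s, b' * b, hs, by noncomm_ring⟩
  | zero => simp
  | add x y _ _ hx hy => rw [mul_add, add_mul]; exact add_mem hx hy
  | smul c x _ hx => 
    rw [mul_smul_comm, smul_mul_assoc]; exact Submodule.smul_mem _ _ hx

theorem commFilt_ideal (n : ℕ) (a b x : R) (hx : x ∈ commFilt k R n) :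
    a * x * b ∈ commFilt k R n := by
  induction n using Nat.strong_induction_on generalizing a b x with
  | _ n ih =>
    cases n with
    | zero => rw [commFilt_zero']; trivial
    | succ n =>
      let T : R →ₗ[k] R := (LinearMap.mulRight k b).comp (LinearMap.mulLeft k a)
      suffices h : commFilt k R (n + 1) ≤ (commFilt k R (n + 1)).comap T from h hx
      conv_lhs => rw [commFilt_succ']
      rw [Submodule.add_eq_sup]
      refine sup_le (finset_sum_submodule_le k _ _ _ fun p hp => ?_)
        (finset_sum_submodule_le k _ _ _ fun p hp => ?_)
      · rw [Submodule.mul_le]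
        intro x hx y hy
        rw [Submodule.mem_comap]
        rw [commFilt_succ', Submodule.add_eq_sup]
        refine Submodule.mem_sup_left (le_finset_sum_submodule k _ _ p hp ?_)
        rw [Finset.mem_Icc] at hp
        have e : T (x * y) = (a * x * 1) * (1 * y * b) := by
          change a * (x * y) * b = _
          noncomm_ring
        rw [e]
        exact Submodule.mul_mem_mul (ih p (by omega) _ _ _ hx)
          (ih (n + 1 - p) (by omega) _ _ _ hy)
      · intro x hx
        rw [Submodule.mem_comap]
        rw [commFilt_succ', Submodule.add_eq_sup]
        refine Submodule.mem_sup_right (le_finset_sum_submodule k _ _ p hp ?_)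
        exact brIdeal_ideal k R _ _ a b x hx

theorem commFilt_mul (p q : ℕ) (x y : R) (hx : x ∈ commFilt k R p)
    (hy : y ∈ commFilt k R q) : x * y ∈ commFilt k R (p + q) := by
  rcases Nat.eq_zero_or_pos p with rfl | hp
  · have := commFilt_ideal k R q x 1 y hy
    rwa [mul_one, ← Nat.zero_add q] at this
  rcases Nat.eq_zero_or_pos q with rfl | hq
  · have := commFilt_ideal k R p 1 y x hx
    rwa [one_mul] at this
  obtain ⟨n, hn⟩ : ∃ n, p + q = n + 1 := ⟨p + q - 1, by omega⟩
  rw [hn, commFilt_succ', Submodule.add_eq_sup]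
  refine Submodule.mem_sup_left (le_finset_sum_submodule k _ _ p (by simp; omega) ?_)
  rw [show n + 1 - p = q by omega]
  exact Submodule.mul_mem_mul hx hy

/-! ### The associated graded algebra, as a quotient of the Rees algebra -/

open Polynomial in
/-- The Rees algebra of the commutator filtration. -/
noncomputable def rees : Subalgebra k R[X] where
  carrier := {f | ∀ n, f.coeff n ∈ commFilt k R n}
  mul_mem' := by
    intro f g hf hg n
    rw [coeff_mul]
    refine Submodule.sum_mem _ fun ij hij => ?_
    rw [Finset.HasAntidiagonal.mem_antidiagonal] at hij
    rw [← hij]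
    exact commFilt_mul k R _ _ _ _ (hf _) (hg _)
  add_mem' := by
    intro f g hf hg n
    rw [coeff_add]
    exact add_mem (hf n) (hg n)
  algebraMap_mem' := by
    intro r n
    rw [Polynomial.algebraMap_apply, coeff_C]
    split_ifs with h
    · subst h; rw [commFilt_zero']; trivial
    · exact zero_mem _

/-- The ideal of the Rees algebra defining the associated graded algebra. -/
def reesI : Ideal (rees k R) where
  carrier := {f | ∀ n, f.1.coeff n ∈ commFilt k R (n + 1)}
  add_mem' := by
    intro f g hf hg n
    have := add_mem (hf n) (hg n)
    simpa using this
  zero_mem' := by intro n; simp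
  smul_mem' := by
    intro c f hf n
    change (c.1 * f.1).coeff n ∈ _
    rw [Polynomial.coeff_mul]
    refine Submodule.sum_mem _ fun ij hij => ?_
    rw [Finset.HasAntidiagonal.mem_antidiagonal] at hij
    rw [← hij, Nat.add_assoc]
    exact commFilt_mul k R _ _ _ _ (c.2 _) (hf _)

theorem mem_reesI (f : rees k R) :
    f ∈ reesI k R ↔ ∀ n, f.1.coeff n ∈ commFilt k R (n + 1) := Iff.rfl

instance reesI_isTwoSided : (reesI k R).IsTwoSided := ⟨by
    intro f c hf n
    change (f.1 * c.1).coeff n ∈ _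
    rw [Polynomial.coeff_mul]
    refine Submodule.sum_mem _ fun ij hij => ?_
    rw [Finset.HasAntidiagonal.mem_antidiagonal] at hij
    rw [← hij, Nat.add_right_comm]
    exact commFilt_mul k R _ _ _ _ (hf _) (c.2 _)⟩

theorem coeff_commutator (f g : Polynomial R) (n : ℕ) :
    (f * g - g * f).coeff n =
      ∑ ij ∈ Finset.HasAntidiagonal.antidiagonal n,
        (f.coeff ij.1 * g.coeff ij.2 - g.coeff ij.2 * f.coeff ij.1) := by
  rw [Polynomial.coeff_sub, Polynomial.coeff_mul, Polynomial.coeff_mul,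
    Finset.sum_sub_distrib]
  congr 1
  rw [← Finset.Nat.sum_antidiagonal_swap]
  rfl

theorem rees_comm_mem (f g : Polynomial R) (a b : ℕ)
    (hf : ∀ n, f.coeff n ∈ commFilt k R (n + a))
    (hg : ∀ n, g.coeff n ∈ commFilt k R (n + b)) (n : ℕ) :
    (f * g - g * f).coeff n ∈ commFilt k R (n + a + b + 1) := by
  rw [coeff_commutator]
  refine Submodule.sum_mem _ fun ij hij => ?_
  rw [Finset.HasAntidiagonal.mem_antidiagonal] at hij
  have := commFilt_comm k R _ _ _ _ (hf ij.1) (hg ij.2)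
  rwa [show ij.1 + a + (ij.2 + b) + 1 = n + a + b + 1 by omega] at this

/-- The associated graded algebra. -/
noncomputable def GrQ : Type := rees k R ⧸ reesI k R

noncomputable instance grCommRing : CommRing (GrQ k R) :=
  { (inferInstance : Ring (rees k R ⧸ reesI k R)) with
    mul_comm := by
      intro a b
      obtain ⟨f, rfl⟩ := Ideal.Quotient.mk_surjective a
      obtain ⟨g, rfl⟩ := Ideal.Quotient.mk_surjective b
      change Ideal.Quotient.mk (reesI k R) (f * g) = Ideal.Quotient.mk (reesI k R) (g * f)
      rw [Ideal.Quotient.eq]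
      intro n
      exact rees_comm_mem k R f.1 g.1 0 0 f.2 g.2 n }

noncomputable instance grAlgebra : Algebra k (GrQ k R) :=
  { (inferInstance : Algebra k (rees k R ⧸ reesI k R)) with }

/-- The quotient map. -/
noncomputable def grMk : rees k R →ₐ[k] GrQ k R :=
  { Ideal.Quotient.mk (reesI k R) with commutes' := fun _ => rfl }

theorem grMk_surj : Function.Surjective (grMk k R) := Ideal.Quotient.mk_surjective

theorem grMk_eq (f g : rees k R) : grMk k R f = grMk k R g ↔ f - g ∈ reesI k R :=
  Ideal.Quotient.eq

/-- The bracket on the Rees algebra. -/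
noncomputable def brR (f g : rees k R) : rees k R :=
  ⟨Polynomial.X * (f.1 * g.1 - g.1 * f.1), by
    intro n
    cases n with
    | zero => simp
    | succ n =>
      rw [Polynomial.coeff_X_mul]
      exact rees_comm_mem k R f.1 g.1 0 0 f.2 g.2 n⟩

theorem brR_val (f g : rees k R) :
    (brR k R f g).1 = Polynomial.X * (f.1 * g.1 - g.1 * f.1) := rfl

theorem brR_mem_left (f g : rees k R) (hf : f ∈ reesI k R) : brR k R f g ∈ reesI k R := by
  intro n
  cases n with
  | zero => simp [brR]
  | succ n =>
    rw [brR_val, Polynomial.coeff_X_mul]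
    exact rees_comm_mem k R f.1 g.1 1 0 hf g.2 n

theorem brR_mem_right (f g : rees k R) (hg : g ∈ reesI k R) : brR k R f g ∈ reesI k R := by
  intro n
  cases n with
  | zero => simp [brR]
  | succ n =>
    rw [brR_val, Polynomial.coeff_X_mul]
    exact rees_comm_mem k R f.1 g.1 0 1 f.2 hg n

theorem grMk_brR_congr (f f' g g' : rees k R) (hf : grMk k R f = grMk k R f')
    (hg : grMk k R g = grMk k R g') : grMk k R (brR k R f g) = grMk k R (brR k R f' g') := by
  rw [grMk_eq] at *
  have e : brR k R f g - brR k R f' g' = brR k R (f - f') g + brR k R f' (g - g') := by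
    apply Subtype.ext
    change Polynomial.X * (f.1 * g.1 - g.1 * f.1) - Polynomial.X * (f'.1 * g'.1 - g'.1 * f'.1)
      = Polynomial.X * ((f.1 - f'.1) * g.1 - g.1 * (f.1 - f'.1)) +
        Polynomial.X * (f'.1 * (g.1 - g'.1) - (g.1 - g'.1) * f'.1)
    noncomm_ring
  rw [e]
  exact add_mem (brR_mem_left k R _ _ hf) (brR_mem_right k R _ _ hg)

/-- The bracket on the associated graded algebra, as a function. -/
noncomputable def brQ (a b : GrQ k R) : GrQ k R :=
  grMk k R (brR k R (Function.surjInv (grMk_surj k R) a) (Function.surjInv (grMk_surj k R) b))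

theorem brQ_mk (f g : rees k R) : brQ k R (grMk k R f) (grMk k R g) = grMk k R (brR k R f g) :=
  grMk_brR_congr k R _ _ _ _ (Function.surjInv_eq _ _) (Function.surjInv_eq _ _)

theorem X_comm_aux (a b : Polynomial R) : a * (Polynomial.X * b) = Polynomial.X * (a * b) := by
  rw [← mul_assoc, ← Polynomial.X_mul, mul_assoc]

/-- The Poisson structure on the associated graded algebra. -/
noncomputable def grPoisson : PoissonStructure k (GrQ k R) where
  bracket := LinearMap.mk₂ k (brQ k R)
    (by
      intro a b c
      obtain ⟨a, rfl⟩ := grMk_surj k R a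
      obtain ⟨b, rfl⟩ := grMk_surj k R b
      obtain ⟨c, rfl⟩ := grMk_surj k R c
      rw [← map_add, brQ_mk, brQ_mk, brQ_mk, ← map_add]
      congr 1
      apply Subtype.ext
      change Polynomial.X * ((a.1 + b.1) * c.1 - c.1 * (a.1 + b.1)) =
        Polynomial.X * (a.1 * c.1 - c.1 * a.1) + Polynomial.X * (b.1 * c.1 - c.1 * b.1)
      noncomm_ring)
    (by
      intro r a c
      obtain ⟨a, rfl⟩ := grMk_surj k R a
      obtain ⟨c, rfl⟩ := grMk_surj k R c
      rw [← map_smul, brQ_mk, brQ_mk, ← map_smul]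
      congr 1
      apply Subtype.ext
      change Polynomial.X * ((r • a.1) * c.1 - c.1 * (r • a.1)) =
        r • (Polynomial.X * (a.1 * c.1 - c.1 * a.1))
      simp only [smul_mul_assoc, mul_smul_comm, ← smul_sub])
    (by
      intro a b c
      obtain ⟨a, rfl⟩ := grMk_surj k R a
      obtain ⟨b, rfl⟩ := grMk_surj k R b
      obtain ⟨c, rfl⟩ := grMk_surj k R c
      rw [← map_add, brQ_mk, brQ_mk, brQ_mk, ← map_add]
      congr 1
      apply Subtype.ext
      change Polynomial.X * (a.1 * (b.1 + c.1) - (b.1 + c.1) * a.1) =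
        Polynomial.X * (a.1 * b.1 - b.1 * a.1) + Polynomial.X * (a.1 * c.1 - c.1 * a.1)
      noncomm_ring)
    (by
      intro r a c
      obtain ⟨a, rfl⟩ := grMk_surj k R a
      obtain ⟨c, rfl⟩ := grMk_surj k R c
      rw [← map_smul, brQ_mk, brQ_mk, ← map_smul]
      congr 1
      apply Subtype.ext
      change Polynomial.X * (a.1 * (r • c.1) - (r • c.1) * a.1) =
        r • (Polynomial.X * (a.1 * c.1 - c.1 * a.1))
      simp only [smul_mul_assoc, mul_smul_comm, ← smul_sub])
  bracket_self := by
    intro a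
    obtain ⟨a, rfl⟩ := grMk_surj k R a
    rw [LinearMap.mk₂_apply, brQ_mk, ← map_zero (grMk k R)]
    congr 1
    apply Subtype.ext
    change Polynomial.X * (a.1 * a.1 - a.1 * a.1) = 0
    simp
  jacobi := by
    intro a b c
    obtain ⟨a, rfl⟩ := grMk_surj k R a
    obtain ⟨b, rfl⟩ := grMk_surj k R b
    obtain ⟨c, rfl⟩ := grMk_surj k R c
    simp only [LinearMap.mk₂_apply, brQ_mk]
    rw [← map_add]
    congr 1
    apply Subtype.ext
    change (brR k R a (brR k R b c)).1 =
      (brR k R (brR k R a b) c).1 + (brR k R b (brR k R a c)).1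
    simp only [brR_val, mul_sub, sub_mul, X_comm_aux, mul_assoc]
    abel
  leibniz := by
    intro a b c
    obtain ⟨a, rfl⟩ := grMk_surj k R a
    obtain ⟨b, rfl⟩ := grMk_surj k R b
    obtain ⟨c, rfl⟩ := grMk_surj k R c
    simp only [LinearMap.mk₂_apply, brQ_mk, ← map_mul]
    rw [← map_add]
    congr 1
    apply Subtype.ext
    change (brR k R a (b * c)).1 =
      (brR k R a b).1 * c.1 + b.1 * (brR k R a c).1
    have e : (b * c).1 = b.1 * c.1 := rfl
    simp only [brR_val, e, mul_sub, sub_mul, X_comm_aux, mul_assoc]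
    abel

theorem grPoisson_mk (f g : rees k R) :
    (grPoisson k R).bracket (grMk k R f) (grMk k R g) = grMk k R (brR k R f g) :=
  brQ_mk k R f g

/-- The class of a homogeneous element. -/
noncomputable def reesMon (n : ℕ) : commFilt k R n →ₗ[k] rees k R where
  toFun x := ⟨Polynomial.monomial n x.1, by
    intro m
    rw [Polynomial.coeff_monomial]
    split_ifs with h
    · subst h; exact x.2
    · exact zero_mem _⟩
  map_add' x y := Subtype.ext ((Polynomial.monomial n).map_add x.1 y.1)
  map_smul' r x := Subtype.ext (Polynomial.smul_monomial r n x.1).symm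

noncomputable def grCls (n : ℕ) : commFilt k R n →ₗ[k] GrQ k R :=
  (grMk k R).toLinearMap.comp (reesMon k R n)

theorem grCls_eq_zero (n : ℕ) (x : commFilt k R n) :
    grCls k R n x = 0 ↔ x.1 ∈ commFilt k R (n + 1) := by
  have h : grCls k R n x = grMk k R (reesMon k R n x) := rfl
  rw [h, ← map_zero (grMk k R), grMk_eq, sub_zero, mem_reesI]
  constructor
  · intro h
    simpa [reesMon] using h n
  · intro hx m
    change (Polynomial.monomial n x.1).coeff m ∈ _
    rw [Polynomial.coeff_monomial]
    split_ifs with h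
    · subst h; exact hx
    · exact zero_mem _

theorem grCls_mul (n m : ℕ) (x : commFilt k R n) (y : commFilt k R m)
    (z : commFilt k R (n + m)) (hz : z.1 = x.1 * y.1) :
    grCls k R (n + m) z = grCls k R n x * grCls k R m y := by
  change grMk k R _ = grMk k R _ * grMk k R _
  rw [← map_mul]
  congr 1
  apply Subtype.ext
  change Polynomial.monomial (n + m) z.1 = Polynomial.monomial n x.1 * Polynomial.monomial m y.1
  rw [Polynomial.monomial_mul_monomial, hz]

theorem grCls_br (n m : ℕ) (x : commFilt k R n) (y : commFilt k R m)
    (z : commFilt k R (n + m + 1)) (hz : z.1 = x.1 * y.1 - y.1 * x.1) :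
    grCls k R (n + m + 1) z = (grPoisson k R).bracket (grCls k R n x) (grCls k R m y) := by
  change grMk k R _ = (grPoisson k R).bracket (grMk k R _) (grMk k R _)
  rw [grPoisson_mk]
  congr 1
  apply Subtype.ext
  change Polynomial.monomial (n + m + 1) z.1 = Polynomial.X *
    (Polynomial.monomial n x.1 * Polynomial.monomial m y.1
      - Polynomial.monomial m y.1 * Polynomial.monomial n x.1)
  rw [Polynomial.monomial_mul_monomial, Polynomial.monomial_mul_monomial, Nat.add_comm m n,
    ← map_sub, Polynomial.X_mul_monomial, hz]

theorem ring_aux₁ {A : Type} [Ring A] (S T M : A) : S * T * M - M * (S * T) =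
    S * (T * M - M * T) + (S * M - M * S) * T := by noncomm_ring

theorem ring_aux₂ {A : Type} [Ring A] (S T M : A) :
    (S * T - T * S) * M - M * (S * T - T * S) =
      (S * (T * M - M * T) - (T * M - M * T) * S) +
      ((S * M - M * S) * T - T * (S * M - M * S)) := by noncomm_ring

theorem ring_aux₃ {A : Type} [Ring A] (a b c d : A) :
    (a + b) * (c + d) - (c + d) * (a + b) =
      (a * c - c * a) + ((a * d - d * a) + (b * c - c * b)) + (b * d - d * b) := by
  noncomm_ring

/-! ### Differential operators -/

/-- `dOp (j+1)`: differential operators of order at most `j`; `dOp 0 = 0`. -/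
noncomputable def dOp : ℕ → Submodule k (Module.End k P)
  | 0 => ⊥
  | j + 1 => ⨅ a : P, (dOp j).comap
      (LinearMap.mulRight k (LinearMap.mulLeft k a : Module.End k P) -
        LinearMap.mulLeft k (LinearMap.mulLeft k a : Module.End k P))

theorem mem_dOp_zero (T : Module.End k P) : T ∈ dOp k P 0 ↔ T = 0 := by
  rw [dOp, Submodule.mem_bot]

theorem mem_dOp_succ (j : ℕ) (T : Module.End k P) : T ∈ dOp k P (j + 1) ↔
    ∀ a : P, T * (LinearMap.mulLeft k a : Module.End k P) -
      (LinearMap.mulLeft k a : Module.End k P) * T ∈ dOp k P j := by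
  rw [dOp, Submodule.mem_iInf]
  rfl

theorem dOp_mono_succ (j : ℕ) (T : Module.End k P) (h : T ∈ dOp k P j) :
    T ∈ dOp k P (j + 1) := by
  induction j generalizing T with
  | zero => rw [mem_dOp_zero] at h; subst h; exact zero_mem _
  | succ j ih =>
    rw [mem_dOp_succ] at h ⊢
    exact fun a => ih _ (h a)

theorem dOp_mono (i j : ℕ) (hij : i ≤ j) (T : Module.End k P) (h : T ∈ dOp k P i) :
    T ∈ dOp k P j := by
  induction hij with
  | refl => exact h
  | step _ ih => exact dOp_mono_succ k P _ _ ih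

theorem dOp_mul (i j l : ℕ) (h : i ≠ 0 → j ≠ 0 → i + j ≤ l + 1) (S T : Module.End k P)
    (hS : S ∈ dOp k P i) (hT : T ∈ dOp k P j) : S * T ∈ dOp k P l := by
  induction l generalizing i j S T with
  | zero =>
    rw [mem_dOp_zero]
    by_cases hi : i = 0
    · subst hi; rw [mem_dOp_zero] at hS; rw [hS, zero_mul]
    by_cases hj : j = 0
    · subst hj; rw [mem_dOp_zero] at hT; rw [hT, mul_zero]
    have := h hi hj
    omega
  | succ l ih =>
    cases i with
    | zero => rw [mem_dOp_zero] at hS; rw [hS, zero_mul]; exact zero_mem _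
    | succ i =>
      cases j with
      | zero => rw [mem_dOp_zero] at hT; rw [hT, mul_zero]; exact zero_mem _
      | succ j =>
        have h' := h (by omega) (by omega)
        rw [mem_dOp_succ]
        intro a
        rw [ring_aux₁]
        refine add_mem (ih (i + 1) j (by omega) _ _ hS ?_) (ih i (j + 1) (by omega) _ _ ?_ hT)
        · exact (mem_dOp_succ k P _ _).1 hT a
        · exact (mem_dOp_succ k P _ _).1 hS a

theorem dOp_one (T : Module.End k P) (h : T ∈ dOp k P 1) (a : P) : T a = T 1 * a := by
  rw [mem_dOp_succ] at h
  have := h a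
  rw [mem_dOp_zero] at this
  have := LinearMap.congr_fun this 1
  simp at this
  rw [sub_eq_zero] at this
  rw [this, mul_comm]

theorem dOp_comm (i j l : ℕ) (h : i ≠ 0 → j ≠ 0 → i + j ≤ l + 2) (S T : Module.End k P)
    (hS : S ∈ dOp k P i) (hT : T ∈ dOp k P j) : S * T - T * S ∈ dOp k P l := by
  induction l generalizing i j S T with
  | zero =>
    rw [mem_dOp_zero]
    by_cases hi : i = 0
    · subst hi; rw [mem_dOp_zero] at hS; rw [hS]; simp
    by_cases hj : j = 0
    · subst hj; rw [mem_dOp_zero] at hT; rw [hT]; simp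
    have := h hi hj
    obtain rfl : i = 1 := by omega
    obtain rfl : j = 1 := by omega
    ext a
    simp only [LinearMap.sub_apply, Module.End.mul_apply, LinearMap.zero_apply]
    rw [dOp_one k P S hS (T a), dOp_one k P T hT (S a), dOp_one k P T hT a,
      dOp_one k P S hS a]
    ring
  | succ l ih =>
    cases i with
    | zero => rw [mem_dOp_zero] at hS; rw [hS]; simp
    | succ i =>
      cases j with
      | zero => rw [mem_dOp_zero] at hT; rw [hT]; simp
      | succ j =>
        have h' := h (by omega) (by omega)
        rw [mem_dOp_succ]
        intro a
        rw [ring_aux₂]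
        refine add_mem (ih (i + 1) j (by omega) _ _ hS ?_) (ih i (j + 1) (by omega) _ _ ?_ hT)
        · exact (mem_dOp_succ k P _ _).1 hT a
        · exact (mem_dOp_succ k P _ _).1 hS a

/-- The filtration on operator-valued polynomials. -/
noncomputable def opFilt (n : ℕ) : Submodule k (Polynomial (Module.End k P)) where
  carrier := {f | ∀ m, f.coeff m ∈ dOp k P (m + 1 - n)}
  add_mem' := by
    intro f g hf hg m
    rw [Polynomial.coeff_add]; exact add_mem (hf m) (hg m)
  zero_mem' := by intro m; rw [Polynomial.coeff_zero]; exact zero_mem _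
  smul_mem' := by
    intro c f hf m
    rw [Polynomial.coeff_smul]; exact Submodule.smul_mem _ _ (hf m)

theorem opFilt_mul (a b : ℕ) (f g : Polynomial (Module.End k P)) (hf : f ∈ opFilt k P a)
    (hg : g ∈ opFilt k P b) : f * g ∈ opFilt k P (a + b) := by
  intro m
  rw [Polynomial.coeff_mul]
  refine Submodule.sum_mem _ fun ij hij => ?_
  rw [Finset.HasAntidiagonal.mem_antidiagonal] at hij
  exact dOp_mul k P _ _ _ (by omega) _ _ (hf ij.1) (hg ij.2)

theorem opFilt_comm (a b : ℕ) (f g : Polynomial (Module.End k P)) (hf : f ∈ opFilt k P a)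
    (hg : g ∈ opFilt k P b) : f * g - g * f ∈ opFilt k P (a + b + 1) := by
  intro m
  rw [coeff_commutator]
  refine Submodule.sum_mem _ fun ij hij => ?_
  rw [Finset.HasAntidiagonal.mem_antidiagonal] at hij
  exact dOp_comm k P _ _ _ (by omega) _ _ (hf ij.1) (hg ij.2)

theorem opFilt_algebraMap (r : k) :
    algebraMap k (Polynomial (Module.End k P)) r ∈ opFilt k P 0 := by
  intro m
  rw [Polynomial.algebraMap_apply, Polynomial.coeff_C]
  split_ifs with h
  · refine dOp_mono k P 1 _ (by omega) _ ?_
    rw [mem_dOp_succ]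
    intro a
    rw [mem_dOp_zero, Algebra.commutes, sub_self]
  · exact zero_mem _

theorem mulLeft_mem_dOp (a : P) : (LinearMap.mulLeft k a : Module.End k P) ∈ dOp k P 1 := by
  rw [mem_dOp_succ]
  intro b
  rw [mem_dOp_zero]
  ext x
  simp
  ring

theorem bracket_mem_dOp (pb : PoissonStructure k P) (a : P) :
    (pb.bracket a : Module.End k P) ∈ dOp k P 2 := by
  rw [mem_dOp_succ]
  intro b
  have e : (pb.bracket a : Module.End k P) * (LinearMap.mulLeft k b : Module.End k P) -
      (LinearMap.mulLeft k b : Module.End k P) * (pb.bracket a : Module.End k P) =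
      LinearMap.mulLeft k (pb.bracket a b) := by
    ext x
    simp [pb.leibniz]
  rw [e]
  exact mulLeft_mem_dOp k P _

theorem pb_antisymm (pb : PoissonStructure k P) (a b : P) :
    pb.bracket a b = - pb.bracket b a := by
  have h := pb.bracket_self (a + b)
  simp only [map_add, LinearMap.add_apply, pb.bracket_self, zero_add, add_zero] at h
  first
    | exact eq_neg_of_add_eq_zero_left h
    | exact eq_neg_of_add_eq_zero_right h

theorem pb_one (pb : PoissonStructure k P) (a : P) : pb.bracket a 1 = 0 := by
  have h := pb.leibniz a 1 1
  rw [mul_one, mul_one, one_mul] at h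
  exact left_eq_add.1 h

theorem pb_algebraMap (pb : PoissonStructure k P) (a : P) (r : k) :
    pb.bracket a (algebraMap k P r) = 0 := by
  rw [Algebra.algebraMap_eq_smul_one, map_smul, pb_one, smul_zero]

/-- Monomials of operator-valued polynomials, `k`-linearly. -/
noncomputable def opMon (d : ℕ) : Module.End k P →ₗ[k] Polynomial (Module.End k P) where
  toFun T := Polynomial.monomial d T
  map_add' x y := (Polynomial.monomial d).map_add x y
  map_smul' r x := (Polynomial.smul_monomial r d x).symm

theorem opMon_mul (i j : ℕ) (S T : Module.End k P) :
    opMon k P i S * opMon k P j T = opMon k P (i + j) (S * T) :=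
  Polynomial.monomial_mul_monomial i j S T

/-- The operator-valued polynomial attached to a Lie element of degree `d`. -/
noncomputable def opLie (pb : PoissonStructure k P) (d : ℕ) :
    P →ₗ[k] Polynomial (Module.End k P) :=
  ((d + 1 : ℕ) : k) • ((opMon k P d).comp (LinearMap.mul k P)) + (opMon k P (d + 1)).comp pb.bracket

theorem opLie_apply (pb : PoissonStructure k P) (d : ℕ) (u : P) :
    opLie k P pb d u = opMon k P d (((d + 1 : ℕ) : k) • LinearMap.mulLeft k u)
      + opMon k P (d + 1) (pb.bracket u) := by
  rw [map_smul]
  rfl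

theorem opLie_comm (pb : PoissonStructure k P) (d : ℕ) (u l : P) :
    opLie k P pb 0 u * opLie k P pb d l - opLie k P pb d l * opLie k P pb 0 u =
      opLie k P pb (d + 1) (pb.bracket u l) := by
  rw [opLie_apply, opLie_apply, opLie_apply]
  refine (ring_aux₃ (A := Polynomial (Module.End k P)) _ _ _ _).trans ?_
  simp only [opMon_mul, Nat.zero_add, Nat.add_zero, Nat.add_comm 1 d, Nat.add_comm 1 (d + 1)]
  have hs : ∀ (i : ℕ) (S T : Module.End k P),
      opMon k P i S - opMon k P i T = opMon k P i (S - T) := fun i S T =>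
    (map_sub (opMon k P i) S T).symm
  refine (congrArg₂ (· + ·) (congrArg₂ (· + ·) (hs _ _ _) (congrArg₂ (· + ·) (hs _ _ _)
    (hs _ _ _))) (hs _ _ _)).trans ?_
  rw [← map_add (opMon k P (d + 1))]
  have e0 : (((1 : ℕ) : k) • LinearMap.mulLeft k u : Module.End k P) *
        (((d + 1 : ℕ) : k) • LinearMap.mulLeft k l : Module.End k P) -
      (((d + 1 : ℕ) : k) • LinearMap.mulLeft k l : Module.End k P) *
        (((1 : ℕ) : k) • LinearMap.mulLeft k u : Module.End k P) = 0 := by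
    ext x
    simp
    ring
  have e1 : ((((1 : ℕ) : k) • LinearMap.mulLeft k u : Module.End k P) *
        (pb.bracket l : Module.End k P) - (pb.bracket l : Module.End k P) *
        (((1 : ℕ) : k) • LinearMap.mulLeft k u : Module.End k P)) +
      ((pb.bracket u : Module.End k P) *
        (((d + 1 : ℕ) : k) • LinearMap.mulLeft k l : Module.End k P) -
      (((d + 1 : ℕ) : k) • LinearMap.mulLeft k l : Module.End k P) *
        (pb.bracket u : Module.End k P)) =
      ((d + 1 + 1 : ℕ) : k) • LinearMap.mulLeft k (pb.bracket u l) := by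
    ext x
    simp only [LinearMap.add_apply, LinearMap.sub_apply, Module.End.mul_apply,
      LinearMap.smul_apply, LinearMap.mulLeft_apply, map_smul, pb.leibniz]
    rw [pb_antisymm k P pb l u]
    simp only [Algebra.smul_def, map_natCast]
    push_cast
    ring
  have e2 : (pb.bracket u : Module.End k P) * (pb.bracket l : Module.End k P) -
      (pb.bracket l : Module.End k P) * (pb.bracket u : Module.End k P) =
      pb.bracket (pb.bracket u l) := by
    ext x
    simp only [LinearMap.sub_apply, Module.End.mul_apply]
    rw [pb.jacobi u l x, add_sub_cancel_right]
  rw [e0, e1, e2, map_zero, zero_add]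

theorem opLie_zero_mem (pb : PoissonStructure k P) (u : P) :
    opLie k P pb 0 u ∈ opFilt k P 0 := by
  rw [opLie_apply]
  refine add_mem ?_ ?_
  · intro m
    change (Polynomial.monomial 0 _).coeff m ∈ _
    rw [Polynomial.coeff_monomial]
    split_ifs with h
    · subst h
      exact Submodule.smul_mem _ _ (mulLeft_mem_dOp k P u)
    · exact zero_mem _
  · intro m
    change (Polynomial.monomial 1 _).coeff m ∈ _
    rw [Polynomial.coeff_monomial]
    split_ifs with h
    · subst h
      exact bracket_mem_dOp k P pb u
    · exact zero_mem _

/-- The representation of the tensor algebra by operator-valued polynomials. -/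
noncomputable def rhoT (pb : PoissonStructure k P) (ιP : V →ₗ[k] P) :
    TensorAlgebra k V →ₐ[k] Polynomial (Module.End k P) :=
  TensorAlgebra.lift k ((opLie k P pb 0).comp ιP)

theorem rhoT_ι (pb : PoissonStructure k P) (ιP : V →ₗ[k] P) (v : V) :
    rhoT k V P pb ιP (TensorAlgebra.ι k v) = opLie k P pb 0 (ιP v) := by
  rw [rhoT, TensorAlgebra.lift_ι_apply]
  rfl

theorem rhoT_mem (pb : PoissonStructure k P) (ιP : V →ₗ[k] P) (n : ℕ)
    (x : TensorAlgebra k V) (hx : x ∈ commFilt k (TensorAlgebra k V) n) :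
    rhoT k V P pb ιP x ∈ opFilt k P n := by
  refine commFilt_le k (TensorAlgebra k V)
    (fun n => (opFilt k P n).comap (rhoT k V P pb ιP).toLinearMap) ?_ ?_ ?_ n hx
  · intro x
    rw [Submodule.mem_comap, AlgHom.toLinearMap_apply]
    induction x using TensorAlgebra.induction with
    | algebraMap r => rw [AlgHom.commutes]; exact opFilt_algebraMap k P r
    | ι v => rw [rhoT_ι]; exact opLie_zero_mem k P pb _
    | mul a b ha hb => rw [map_mul]; exact opFilt_mul k P 0 0 _ _ ha hb
    | add a b ha hb => rw [map_add]; exact add_mem ha hb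
  · intro p q x y hx hy
    rw [Submodule.mem_comap, AlgHom.toLinearMap_apply] at *
    rw [map_mul]
    exact opFilt_mul k P _ _ _ _ hx hy
  · intro p q x y hx hy
    rw [Submodule.mem_comap, AlgHom.toLinearMap_apply] at *
    rw [map_sub, map_mul, map_mul]
    exact opFilt_comm k P _ _ _ _ hx hy

/-- The symbol map of degree `n`. -/
noncomputable def symb (pb : PoissonStructure k P) (ιP : V →ₗ[k] P) (n : ℕ) :
    TensorAlgebra k V →ₗ[k] P :=
  (LinearMap.applyₗ (1 : P)).comp
    ((Polynomial.lcoeff (Module.End k P) n).restrictScalars k ∘ₗ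
      (rhoT k V P pb ιP).toLinearMap)

theorem symb_apply (pb : PoissonStructure k P) (ιP : V →ₗ[k] P) (n : ℕ)
    (x : TensorAlgebra k V) : symb k V P pb ιP n x = (rhoT k V P pb ιP x).coeff n 1 := rfl

theorem symb_eq_zero (pb : PoissonStructure k P) (ιP : V →ₗ[k] P) (n : ℕ)
    (x : TensorAlgebra k V) (hx : x ∈ commFilt k (TensorAlgebra k V) (n + 1)) :
    symb k V P pb ιP n x = 0 := by
  have h := rhoT_mem k V P pb ιP _ x hx n
  rw [Nat.sub_self, mem_dOp_zero] at h
  rw [symb_apply, h, LinearMap.zero_apply]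

theorem symb_mul (pb : PoissonStructure k P) (ιP : V →ₗ[k] P) (n m : ℕ)
    (x y : TensorAlgebra k V) (hx : x ∈ commFilt k (TensorAlgebra k V) n)
    (hy : y ∈ commFilt k (TensorAlgebra k V) m) :
    symb k V P pb ιP (n + m) (x * y) = symb k V P pb ιP n x * symb k V P pb ιP m y := by
  have hx' := rhoT_mem k V P pb ιP _ x hx
  have hy' := rhoT_mem k V P pb ιP _ y hy
  rw [symb_apply, map_mul, Polynomial.coeff_mul, Finset.sum_eq_single (n, m)]
  · rw [Module.End.mul_apply, dOp_one k P _ (by simpa using hx' n)]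
    rfl
  · rintro ⟨i, j⟩ hij hne
    rw [Finset.HasAntidiagonal.mem_antidiagonal] at hij
    simp only at hij ⊢
    rcases lt_or_ge i n with h | h
    · have := hx' i
      rw [Nat.sub_eq_zero_of_le (by omega), mem_dOp_zero] at this
      rw [this, zero_mul]
    · have hj : j < m := by
        by_contra hj
        exact hne (by ext <;> simp <;> omega)
      have := hy' j
      rw [Nat.sub_eq_zero_of_le (by omega), mem_dOp_zero] at this
      rw [this, mul_zero]
  · intro h
    exact absurd (Finset.HasAntidiagonal.mem_antidiagonal (a := (n, m)).2 rfl) h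

/-- The total symbol on polynomials. -/
noncomputable def symbPoly (pb : PoissonStructure k P) (ιP : V →ₗ[k] P) :
    Polynomial (TensorAlgebra k V) →ₗ[k] P :=
  Polynomial.lsum (symb k V P pb ιP)

theorem symbPoly_monomial (pb : PoissonStructure k P) (ιP : V →ₗ[k] P) (n : ℕ)
    (x : TensorAlgebra k V) :
    symbPoly k V P pb ιP (Polynomial.monomial n x) = symb k V P pb ιP n x := by
  rw [symbPoly, Polynomial.lsum_apply, Polynomial.sum_monomial_index]
  exact map_zero _

theorem symbPoly_mul (pb : PoissonStructure k P) (ιP : V →ₗ[k] P)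
    (f g : Polynomial (TensorAlgebra k V)) (hf : f ∈ rees k (TensorAlgebra k V))
    (hg : g ∈ rees k (TensorAlgebra k V)) :
    symbPoly k V P pb ιP (f * g) = symbPoly k V P pb ιP f * symbPoly k V P pb ιP g := by
  conv_lhs => rw [f.as_sum_support, g.as_sum_support]
  conv_rhs => rw [f.as_sum_support, g.as_sum_support]
  rw [Finset.sum_mul_sum, map_sum, map_sum, map_sum, Finset.sum_mul_sum]
  refine Finset.sum_congr rfl fun i _ => ?_
  rw [map_sum]
  refine Finset.sum_congr rfl fun j _ => ?_
  rw [Polynomial.monomial_mul_monomial, symbPoly_monomial, symbPoly_monomial,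
    symbPoly_monomial, symb_mul k V P pb ιP i j _ _ (hf i) (hg j)]

/-- The symbol map on the Rees algebra. -/
noncomputable def symbRees (pb : PoissonStructure k P) (ιP : V →ₗ[k] P) :
    rees k (TensorAlgebra k V) →ₐ[k] P :=
  AlgHom.ofLinearMap
    ((symbPoly k V P pb ιP).comp (rees k (TensorAlgebra k V)).val.toLinearMap)
    (by
      change symbPoly k V P pb ιP 1 = 1
      rw [← Polynomial.monomial_zero_one, symbPoly_monomial, symb_apply, map_one (rhoT k V P pb ιP),
        Polynomial.coeff_one_zero]
      rfl)
    (fun f g => symbPoly_mul k V P pb ιP f.1 g.1 f.2 g.2)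

/-- The symbol map on the associated graded algebra. -/
noncomputable def symbGr (pb : PoissonStructure k P) (ιP : V →ₗ[k] P) :
    GrQ k (TensorAlgebra k V) →ₐ[k] P :=
  Ideal.Quotient.liftₐ (reesI k (TensorAlgebra k V)) (symbRees k V P pb ιP) (by
    intro f hf
    change symbPoly k V P pb ιP f.1 = 0
    rw [f.1.as_sum_support, map_sum]
    refine Finset.sum_eq_zero fun i _ => ?_
    rw [symbPoly_monomial]
    exact symb_eq_zero k V P pb ιP i _ (hf i))

theorem symbGr_cls (pb : PoissonStructure k P) (ιP : V →ₗ[k] P) (n : ℕ)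
    (x : commFilt k (TensorAlgebra k V) n) :
    symbGr k V P pb ιP (grCls k _ n x) = symb k V P pb ιP n x.1 :=
  symbPoly_monomial k V P pb ιP n x.1

theorem grCls_congr (n m : ℕ) (h : n = m) (x : commFilt k R n) (y : commFilt k R m)
    (hxy : x.1 = y.1) : grCls k R n x = grCls k R m y := by
  subst h
  rw [Subtype.ext hxy]

theorem exists_left_inv (Q : Type) [CommRing Q] [Algebra k Q] (ψ : P →ₐ[k] Q)
    (hinj : Function.Injective ψ) : ∃ χ : Q →ₗ[k] P, ∀ a, χ (ψ a) = a := by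
  obtain ⟨χ, hχ⟩ := LinearMap.exists_leftInverse_of_injective ψ.toLinearMap
    (LinearMap.ker_eq_bot.2 hinj)
  exact ⟨χ, fun a => LinearMap.congr_fun hχ a⟩

/-! ### The free Poisson algebra -/

theorem pGrade_bracket (pb : PoissonStructure k P) (ιP : V →ₗ[k] P) (a b : ℕ) (x y : P)
    (hx : x ∈ pGrade k V P pb ιP a) (hy : y ∈ pGrade k V P pb ιP b) :
    pb.bracket x y ∈ pGrade k V P pb ιP (a + b + 1) := by
  induction a generalizing b x y with
  | zero =>
    rw [pGrade] at hx
    rw [Nat.zero_add, pGrade]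
    exact Submodule.subset_span ⟨x, hx, y, hy, rfl⟩
  | succ a ih =>
    rw [pGrade] at hx
    induction hx using Submodule.span_induction with
    | mem x hx =>
      obtain ⟨v, hv, x', hx', rfl⟩ := hx
      have e : pb.bracket (pb.bracket v x') y =
          pb.bracket v (pb.bracket x' y) - pb.bracket x' (pb.bracket v y) := by
        rw [pb.jacobi v x' y, add_sub_cancel_right]
      rw [e]
      refine sub_mem ?_ ?_
      · rw [pGrade]
        refine Submodule.subset_span ⟨v, hv, _, ?_, rfl⟩
        rw [Nat.add_right_comm a 1 b]
        exact ih b x' y hx' hy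
      · have h1 : pb.bracket v y ∈ pGrade k V P pb ιP (b + 1) := by
          rw [pGrade]
          exact Submodule.subset_span ⟨v, hv, y, hy, rfl⟩
        have h2 := ih (b + 1) x' _ hx' h1
        rwa [show a + (b + 1) + 1 = a + 1 + b + 1 by omega] at h2
    | zero => simp
    | add x x' _ _ hx hx' => rw [map_add, LinearMap.add_apply]; exact add_mem hx hx'
    | smul c x _ hx => rw [map_smul, LinearMap.smul_apply]; exact Submodule.smul_mem _ _ hx

theorem pHomog_le (pb : PoissonStructure k P) (ιP : V →ₗ[k] P) (G : ℕ → Submodule k P)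
    (h1 : (1 : P) ∈ G 0)
    (hmul : ∀ d n x y, x ∈ pGrade k V P pb ιP d → y ∈ G n → x * y ∈ G (d + n)) (n : ℕ) :
    pHomog k V P pb ιP n ≤ G n := by
  rw [pHomog]
  refine iSup₂_le ?_
  rintro l rfl
  induction l with
  | nil => simpa using h1
  | cons d l ih =>
    rw [List.map_cons, List.prod_cons, List.sum_cons, Submodule.mul_le]
    exact fun x hx y hy => hmul _ _ x y hx (ih hy)

theorem pHomog_one (pb : PoissonStructure k P) (ιP : V →ₗ[k] P) :
    (1 : P) ∈ pHomog k V P pb ιP 0 := by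
  rw [pHomog]
  refine Submodule.mem_iSup_of_mem [] (Submodule.mem_iSup_of_mem rfl ?_)
  rw [List.map_nil, List.prod_nil]
  exact Submodule.one_le.1 le_rfl

theorem pHomog_mul (pb : PoissonStructure k P) (ιP : V →ₗ[k] P) (p q : ℕ) (x y : P)
    (hx : x ∈ pHomog k V P pb ιP p) (hy : y ∈ pHomog k V P pb ιP q) :
    x * y ∈ pHomog k V P pb ιP (p + q) := by
  suffices h : pHomog k V P pb ιP p * pHomog k V P pb ιP q ≤ pHomog k V P pb ιP (p + q) from
    h (Submodule.mul_mem_mul hx hy)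
  conv_lhs => rw [pHomog, pHomog]
  simp only [Submodule.iSup_mul, Submodule.mul_iSup]
  refine iSup_le fun l => iSup_le fun hl => iSup_le fun l' => iSup_le fun hl' => ?_
  rw [← List.prod_append, ← List.map_append, pHomog]
  refine le_iSup₂_of_le _ ?_ le_rfl
  rw [List.sum_append]
  omega

theorem pGrade_le_pHomog (pb : PoissonStructure k P) (ιP : V →ₗ[k] P) (d : ℕ) (x : P)
    (hx : x ∈ pGrade k V P pb ιP d) : x ∈ pHomog k V P pb ιP d := by
  rw [pHomog]
  refine Submodule.mem_iSup_of_mem [d] (Submodule.mem_iSup_of_mem (by simp) ?_)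
  simpa using hx

theorem pHomog_bracket_aux (pb : PoissonStructure k P) (ιP : V →ₗ[k] P) (p : ℕ) (x : P)
    (hg : ∀ d y, y ∈ pGrade k V P pb ιP d → pb.bracket x y ∈ pHomog k V P pb ιP (p + d + 1))
    (q : ℕ) (y : P) (hy : y ∈ pHomog k V P pb ιP q) :
    pb.bracket x y ∈ pHomog k V P pb ιP (p + q + 1) := by
  suffices h : pHomog k V P pb ιP q ≤ pHomog k V P pb ιP q ⊓
      (pHomog k V P pb ιP (p + q + 1)).comap (pb.bracket x) from (h hy).2
  refine pHomog_le k V P pb ιP (fun q => pHomog k V P pb ιP q ⊓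
      (pHomog k V P pb ιP (p + q + 1)).comap (pb.bracket x)) ⟨pHomog_one k V P pb ιP, ?_⟩ ?_ q
  · rw [SetLike.mem_coe, Submodule.mem_comap, pb_one]
    exact zero_mem _
  · rintro d n c m hc ⟨hm, hm'⟩
    refine ⟨pHomog_mul k V P pb ιP _ _ _ _ (pGrade_le_pHomog k V P pb ιP _ _ hc) hm, ?_⟩
    rw [SetLike.mem_coe, Submodule.mem_comap] at hm' ⊢
    rw [pb.leibniz]
    refine add_mem ?_ ?_
    · have := pHomog_mul k V P pb ιP _ _ _ _ (hg d c hc) hm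
      rwa [show p + d + 1 + n = p + (d + n) + 1 by omega] at this
    · have := pHomog_mul k V P pb ιP _ _ _ _ (pGrade_le_pHomog k V P pb ιP _ _ hc) hm'
      rwa [show d + (p + n + 1) = p + (d + n) + 1 by omega] at this

theorem pHomog_bracket (pb : PoissonStructure k P) (ιP : V →ₗ[k] P) (p q : ℕ) (x y : P)
    (hx : x ∈ pHomog k V P pb ιP p) (hy : y ∈ pHomog k V P pb ιP q) :
    pb.bracket x y ∈ pHomog k V P pb ιP (p + q + 1) := by
  refine pHomog_bracket_aux k V P pb ιP p x (fun d z hz => ?_) q y hy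
  rw [pb_antisymm, Nat.add_comm p d]
  refine neg_mem (pHomog_bracket_aux k V P pb ιP d z (fun e w hw => ?_) p x hx)
  exact pGrade_le_pHomog k V P pb ιP _ _ (pGrade_bracket k V P pb ιP _ _ _ _ hz hw)

/-- The subalgebra generated by the Lie elements. -/
noncomputable def lieAdj (pb : PoissonStructure k P) (ιP : V →ₗ[k] P) : Subalgebra k P :=
  Algebra.adjoin k {x | ∃ d, x ∈ pGrade k V P pb ιP d}

theorem lieAdj_bracket_aux (pb : PoissonStructure k P) (ιP : V →ₗ[k] P) (x : P)
    (hg : ∀ d y, y ∈ pGrade k V P pb ιP d → pb.bracket x y ∈ lieAdj k V P pb ιP)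
    (y : P) (hy : y ∈ lieAdj k V P pb ιP) : pb.bracket x y ∈ lieAdj k V P pb ιP := by
  have hy' := hy
  rw [lieAdj] at hy'
  induction hy' using Algebra.adjoin_induction with
  | mem y h => obtain ⟨d, h⟩ := h; exact hg d y h
  | algebraMap r => rw [pb_algebraMap]; exact zero_mem _
  | add a b ha hb iha ihb => rw [map_add]; exact add_mem (iha ha) (ihb hb)
  | mul a b ha hb iha ihb =>
    rw [pb.leibniz]
    exact add_mem (mul_mem (iha ha) hb) (mul_mem ha (ihb hb))

theorem lieAdj_bracket (pb : PoissonStructure k P) (ιP : V →ₗ[k] P) (x y : P)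
    (hx : x ∈ lieAdj k V P pb ιP) (hy : y ∈ lieAdj k V P pb ιP) :
    pb.bracket x y ∈ lieAdj k V P pb ιP := by
  refine lieAdj_bracket_aux k V P pb ιP x (fun d z hz => ?_) y hy
  rw [pb_antisymm]
  refine neg_mem (lieAdj_bracket_aux k V P pb ιP z (fun e w hw => ?_) x hx)
  exact Algebra.subset_adjoin ⟨_, pGrade_bracket k V P pb ιP _ _ _ _ hz hw⟩

/-- The Poisson structure on the subalgebra generated by the Lie elements. -/
noncomputable def lieAdjPoisson (pb : PoissonStructure k P) (ιP : V →ₗ[k] P) :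
    PoissonStructure k (lieAdj k V P pb ιP) where
  bracket := LinearMap.mk₂ k
    (fun x y => ⟨pb.bracket x.1 y.1, lieAdj_bracket k V P pb ιP _ _ x.2 y.2⟩)
    (fun x y z => Subtype.ext (by simp))
    (fun c x z => Subtype.ext (by simp))
    (fun x y z => Subtype.ext (by simp))
    (fun c x z => Subtype.ext (by simp))
  bracket_self a := Subtype.ext (pb.bracket_self a.1)
  jacobi a b c := Subtype.ext (pb.jacobi a.1 b.1 c.1)
  leibniz a b c := Subtype.ext (pb.leibniz a.1 b.1 c.1)

theorem lieAdj_eq_top (pb : PoissonStructure k P) (ιP : V →ₗ[k] P)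
    (hP : ∀ (Q : Type) [CommRing Q] [Algebra k Q] (qb : PoissonStructure k Q)
        (f : V →ₗ[k] Q),
      ∃! g : P →ₐ[k] Q,
        (∀ x y : P, g (pb.bracket x y) = qb.bracket (g x) (g y)) ∧
          g.toLinearMap.comp ιP = f) (x : P) : x ∈ lieAdj k V P pb ιP := by
  let ι' : V →ₗ[k] lieAdj k V P pb ιP := ιP.codRestrict
    (Subalgebra.toSubmodule (lieAdj k V P pb ιP))
    (fun v => Algebra.subset_adjoin ⟨0, by rw [pGrade]; exact ⟨v, rfl⟩⟩)
  obtain ⟨g, ⟨hg1, hg2⟩, -⟩ := hP _ (lieAdjPoisson k V P pb ιP) ι'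
  obtain ⟨g', -, hu⟩ := hP P pb ιP
  have e1 := hu (AlgHom.id k P) ⟨fun _ _ => rfl, rfl⟩
  have e2 := hu ((lieAdj k V P pb ιP).val.comp g) ⟨fun x y => by
    change (g (pb.bracket x y)).1 = _
    rw [hg1]
    rfl, by
    ext v
    have := LinearMap.congr_fun hg2 v
    exact congrArg Subtype.val this⟩
  have e3 := congrArg (fun h : P →ₐ[k] P => h x) (e2.trans e1.symm)
  have e4 : (g x).1 = x := e3
  rw [← e4]
  exact (g x).2

/-- An algebra endomorphism acting on Lie elements by nonzero scalars is injective. -/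
theorem theta_injective (pb : PoissonStructure k P) (ιP : V →ₗ[k] P)
    (htop : ∀ x, x ∈ lieAdj k V P pb ιP) (θ : P →ₐ[k] P)
    (hθ : ∀ d x, x ∈ pGrade k V P pb ιP d → θ x = ((d + 1 : ℕ) : k) • x) (a : P)
    (ha : θ a = 0) : a = 0 := by
  set T : Module.End k P := θ.toLinearMap with hT
  set W : Submodule k P := ⨆ j, ⨆ (_ : j ≠ (0 : k)), T.eigenspace j with hW
  have hmem : ∀ (j : k) (x : P), j ≠ 0 → θ x = j • x → x ∈ W := by
    intro j x hj hx
    refine Submodule.mem_iSup_of_mem j (Submodule.mem_iSup_of_mem hj ?_)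
    rw [Module.End.mem_eigenspace_iff]
    exact hx
  have hmul : ∀ x y, x ∈ W → y ∈ W → x * y ∈ W := by
    intro x y hx hy
    suffices h : W * W ≤ W from h (Submodule.mul_mem_mul hx hy)
    conv_lhs => rw [hW]
    simp only [Submodule.iSup_mul, Submodule.mul_iSup]
    refine iSup_le fun i => iSup_le fun hi => iSup_le fun j => iSup_le fun hj => ?_
    rw [Submodule.mul_le]
    intro x hx y hy
    rw [Module.End.mem_eigenspace_iff] at hx hy
    change θ x = _ at hx
    change θ y = _ at hy
    refine hmem (i * j) _ (mul_ne_zero hi hj) ?_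
    rw [map_mul, hx, hy, smul_mul_smul_comm, mul_comm j i]
  have hall : a ∈ W := by
    have h := htop a
    rw [lieAdj] at h
    clear ha
    induction h using Algebra.adjoin_induction with
    | mem y h =>
      obtain ⟨d, h⟩ := h
      exact hmem _ y (by exact_mod_cast Nat.succ_ne_zero d) (hθ d y h)
    | algebraMap r => exact hmem 1 _ one_ne_zero (by rw [AlgHom.commutes, one_smul])
    | add a b _ _ iha ihb => exact add_mem iha ihb
    | mul a b _ _ iha ihb => exact hmul a b iha ihb
  have h0 : a ∈ T.eigenspace 0 := by
    rw [Module.End.mem_eigenspace_iff, zero_smul]; exact ha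
  exact Submodule.disjoint_def.1 (Module.End.eigenspaces_iSupIndep T 0) a h0 hall

/-! ### The comparison map -/

theorem lie_lift (pb : PoissonStructure k P) (ιP : V →ₗ[k] P)
    (ψ : P →ₐ[k] GrQ k (TensorAlgebra k V))
    (hψ : ∀ x y, ψ (pb.bracket x y) =
      (grPoisson k (TensorAlgebra k V)).bracket (ψ x) (ψ y))
    (hι : ∀ (v : V) (x : commFilt k (TensorAlgebra k V) 0), x.1 = TensorAlgebra.ι k v →
      ψ (ιP v) = grCls k _ 0 x) (d : ℕ) (l : P) (hl : l ∈ pGrade k V P pb ιP d) :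
    ∃ x : commFilt k (TensorAlgebra k V) d, ψ l = grCls k _ d x ∧
      rhoT k V P pb ιP x.1 = opLie k P pb d l := by
  induction d generalizing l with
  | zero =>
    rw [pGrade] at hl
    obtain ⟨v, rfl⟩ := hl
    exact ⟨⟨TensorAlgebra.ι k v, by rw [commFilt_zero']; trivial⟩, hι v _ rfl,
      rhoT_ι k V P pb ιP v⟩
  | succ d ih =>
    rw [pGrade] at hl
    induction hl using Submodule.span_induction with
    | mem l hl =>
      obtain ⟨_, ⟨v, rfl⟩, l', hl', rfl⟩ := hl
      obtain ⟨y, hy1, hy2⟩ := ih l' hl'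
      let x : commFilt k (TensorAlgebra k V) 0 :=
        ⟨TensorAlgebra.ι k v, by rw [commFilt_zero']; trivial⟩
      have hz := commFilt_comm k (TensorAlgebra k V) 0 d x.1 y.1 x.2 y.2
      rw [Nat.zero_add] at hz
      refine ⟨⟨x.1 * y.1 - y.1 * x.1, hz⟩, ?_, ?_⟩
      · rw [hψ, hι v x rfl, hy1, ← grCls_br k _ 0 d x y
          ⟨x.1 * y.1 - y.1 * x.1, by rw [Nat.zero_add]; exact hz⟩ rfl]
        exact grCls_congr k _ _ _ (by omega) _ _ rfl
      · change rhoT k V P pb ιP (x.1 * y.1 - y.1 * x.1) = _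
        rw [map_sub, map_mul, map_mul, hy2, rhoT_ι, opLie_comm]
    | zero => exact ⟨0, by simp, by simp⟩
    | add a b _ _ iha ihb =>
      obtain ⟨x, hx1, hx2⟩ := iha
      obtain ⟨y, hy1, hy2⟩ := ihb
      exact ⟨x + y, by rw [map_add, map_add, hx1, hy1],
        by rw [Submodule.coe_add, map_add, map_add, hx2, hy2]⟩
    | smul c a _ iha =>
      obtain ⟨x, hx1, hx2⟩ := iha
      exact ⟨c • x, by rw [map_smul, map_smul, hx1],
        by rw [Submodule.coe_smul, map_smul, map_smul, hx2]⟩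

theorem symb_of_lie (pb : PoissonStructure k P) (ιP : V →ₗ[k] P) (d : ℕ) (l : P)
    (x : TensorAlgebra k V) (hx : rhoT k V P pb ιP x = opLie k P pb d l) :
    symb k V P pb ιP d x = ((d + 1 : ℕ) : k) • l := by
  rw [symb_apply, hx, opLie_apply, Polynomial.coeff_add]
  change ((Polynomial.monomial d _).coeff d + (Polynomial.monomial (d + 1) _).coeff d :
    Module.End k P) 1 = _
  rw [Polynomial.coeff_monomial_same, Polynomial.coeff_monomial_of_ne _ (by omega), add_zero]
  simp

theorem psi_injective (pb : PoissonStructure k P) (ιP : V →ₗ[k] P)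
    (htop : ∀ x, x ∈ lieAdj k V P pb ιP)
    (ψ : P →ₐ[k] GrQ k (TensorAlgebra k V))
    (hψ : ∀ x y, ψ (pb.bracket x y) =
      (grPoisson k (TensorAlgebra k V)).bracket (ψ x) (ψ y))
    (hι : ∀ (v : V) (x : commFilt k (TensorAlgebra k V) 0), x.1 = TensorAlgebra.ι k v →
      ψ (ιP v) = grCls k _ 0 x) : Function.Injective ψ := by
  rw [injective_iff_map_eq_zero]
  intro a ha
  refine theta_injective k V P pb ιP htop ((symbGr k V P pb ιP).comp ψ) ?_ a ?_
  · intro d l hl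
    obtain ⟨x, hx1, hx2⟩ := lie_lift k V P pb ιP ψ hψ hι d l hl
    rw [AlgHom.comp_apply, hx1, symbGr_cls]
    exact symb_of_lie k V P pb ιP d l x.1 hx2
  · rw [AlgHom.comp_apply, ha, map_zero]

theorem grCls_one (x : commFilt k R 0) (hx : x.1 = 1) : grCls k R 0 x = 1 := by
  change grMk k R _ = 1
  rw [← map_one (grMk k R)]
  congr 1
  apply Subtype.ext
  change Polynomial.monomial 0 x.1 = 1
  rw [hx, Polynomial.monomial_zero_one]

/-- Every homogeneous class comes from `pHomog`. -/
theorem psi_onto (pb : PoissonStructure k P) (ιP : V →ₗ[k] P)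
    (ψ : P →ₐ[k] GrQ k (TensorAlgebra k V))
    (hψ : ∀ x y, ψ (pb.bracket x y) =
      (grPoisson k (TensorAlgebra k V)).bracket (ψ x) (ψ y))
    (hι : ∀ (v : V) (x : commFilt k (TensorAlgebra k V) 0), x.1 = TensorAlgebra.ι k v →
      ψ (ιP v) = grCls k _ 0 x) (n : ℕ) (x : commFilt k (TensorAlgebra k V) n) :
    ∃ a ∈ pHomog k V P pb ιP n, ψ a = grCls k _ n x := by
  let G : ℕ → Submodule k (TensorAlgebra k V) := fun n =>
    (((pHomog k V P pb ιP n).map ψ.toLinearMap).comap (grCls k (TensorAlgebra k V) n)).map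
      (commFilt k (TensorAlgebra k V) n).subtype
  have hG : ∀ n x, x ∈ G n ↔ ∃ hx : x ∈ commFilt k (TensorAlgebra k V) n,
      ∃ a ∈ pHomog k V P pb ιP n, ψ a = grCls k _ n ⟨x, hx⟩ := by
    intro n x
    constructor
    · rintro ⟨y, ⟨a, ha, hay⟩, rfl⟩
      exact ⟨y.2, a, ha, hay⟩
    · rintro ⟨hx, a, ha, hax⟩
      exact ⟨⟨x, hx⟩, ⟨a, ha, hax⟩, rfl⟩
  have hmul : ∀ p q x y, x ∈ G p → y ∈ G q → x * y ∈ G (p + q) := by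
    intro p q x y hx hy
    rw [hG] at hx hy ⊢
    obtain ⟨hx, a, ha, hax⟩ := hx
    obtain ⟨hy, b, hb, hby⟩ := hy
    refine ⟨commFilt_mul k _ _ _ _ _ hx hy, a * b, pHomog_mul k V P pb ιP _ _ _ _ ha hb, ?_⟩
    rw [map_mul, hax, hby]
    exact (grCls_mul k _ p q _ _ _ rfl).symm
  have h : x.1 ∈ G n := by
    refine commFilt_le k (TensorAlgebra k V) G ?_ hmul ?_ n x.2
    · intro x
      induction x using TensorAlgebra.induction with
      | algebraMap r =>
        rw [Algebra.algebraMap_eq_smul_one]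
        refine Submodule.smul_mem _ _ ?_
        rw [hG]
        refine ⟨by rw [commFilt_zero']; trivial, 1, pHomog_one k V P pb ιP, ?_⟩
        rw [map_one, grCls_one]
        rfl
      | ι v =>
        rw [hG]
        exact ⟨by rw [commFilt_zero']; trivial, ιP v,
          pGrade_le_pHomog k V P pb ιP 0 _ (by rw [pGrade]; exact ⟨v, rfl⟩), hι v _ rfl⟩
      | mul a b ha hb => exact hmul 0 0 a b ha hb
      | add a b ha hb => exact add_mem ha hb
    · intro p q x y hx hy
      rw [hG] at hx hy ⊢
      obtain ⟨hx, a, ha, hax⟩ := hx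
      obtain ⟨hy, b, hb, hby⟩ := hy
      refine ⟨commFilt_comm k _ _ _ _ _ hx hy, pb.bracket a b,
        pHomog_bracket k V P pb ιP _ _ _ _ ha hb, ?_⟩
      rw [hψ, hax, hby]
      exact (grCls_br k _ p q _ _ _ rfl).symm
  rw [hG] at h
  obtain ⟨_, h⟩ := h
  exact h

/-- Conversely `ψ` maps `pHomog n` to homogeneous classes. -/
theorem psi_homog (pb : PoissonStructure k P) (ιP : V →ₗ[k] P)
    (ψ : P →ₐ[k] GrQ k (TensorAlgebra k V))
    (hψ : ∀ x y, ψ (pb.bracket x y) =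
      (grPoisson k (TensorAlgebra k V)).bracket (ψ x) (ψ y))
    (hι : ∀ (v : V) (x : commFilt k (TensorAlgebra k V) 0), x.1 = TensorAlgebra.ι k v →
      ψ (ιP v) = grCls k _ 0 x) (n : ℕ) (a : P) (ha : a ∈ pHomog k V P pb ιP n) :
    ∃ x, ψ a = grCls k (TensorAlgebra k V) n x := by
  have h : pHomog k V P pb ιP n ≤
      (LinearMap.range (grCls k (TensorAlgebra k V) n)).comap ψ.toLinearMap := by
    refine pHomog_le k V P pb ιP
      (fun n => (LinearMap.range (grCls k (TensorAlgebra k V) n)).comap ψ.toLinearMap) ?_ ?_ n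
    · refine ⟨⟨1, by rw [commFilt_zero']; trivial⟩, ?_⟩
      rw [grCls_one _ _ _ rfl]
      exact (map_one ψ).symm
    · rintro d n x y hx ⟨z, hz⟩
      obtain ⟨w, hw, -⟩ := lie_lift k V P pb ιP ψ hψ hι d x hx
      refine ⟨⟨w.1 * z.1, commFilt_mul k _ _ _ _ _ w.2 z.2⟩, ?_⟩
      rw [grCls_mul k _ d n w z _ rfl, ← hw, hz]
      exact (map_mul ψ x y).symm
  obtain ⟨x, hx⟩ := h ha
  exact ⟨x, hx.symm⟩

end Helpers

/-- Corollary 2.2: the associated graded Poisson algebra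
`⊕ₙ F_n T V / F_{n+1} T V` of the tensor algebra with respect to the commutator
filtration is isomorphic to the free Poisson algebra `S(L V)` on `V` (witnessed as a
Poisson algebra `P` with generator map `ιP` having the free universal property), via
the natural map sending the class of a bracket-degree-`n` element to its symbol:
there is a family of injective linear maps `Φ n : F_n T V / F_{n+1} T V → P` onto the
homogeneous components of `P`, sending `ι v` to `ιP v` and compatible with the
induced products and brackets. -/
theorem gr_tensorAlgebra_iso_free_poisson
    (pb : PoissonStructure k P) (ιP : V →ₗ[k] P)
    (hP : ∀ (Q : Type) [CommRing Q] [Algebra k Q] (qb : PoissonStructure k Q)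
        (f : V →ₗ[k] Q),
      ∃! g : P →ₐ[k] Q,
        (∀ x y : P, g (pb.bracket x y) = qb.bracket (g x) (g y)) ∧
          g.toLinearMap.comp ιP = f) :
    ∃ Φ : ∀ n : ℕ, grTV k V n →ₗ[k] P,
      (∀ n, Function.Injective (Φ n)) ∧
      (∀ n, LinearMap.range (Φ n) = pHomog k V P pb ιP n) ∧
      (∀ (v : V) (x : ↥(commFilt k (TensorAlgebra k V) 0)),
        (x : TensorAlgebra k V) = TensorAlgebra.ι k v →
          Φ 0 (Submodule.Quotient.mk x) = ιP v) ∧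
      (∀ (n m : ℕ) (x : ↥(commFilt k (TensorAlgebra k V) n))
          (y : ↥(commFilt k (TensorAlgebra k V) m))
          (z : ↥(commFilt k (TensorAlgebra k V) (n + m))),
        (z : TensorAlgebra k V) = (x : TensorAlgebra k V) * y →
          Φ (n + m) (Submodule.Quotient.mk z) =
            Φ n (Submodule.Quotient.mk x) * Φ m (Submodule.Quotient.mk y)) ∧
      (∀ (n m : ℕ) (x : ↥(commFilt k (TensorAlgebra k V) n))
          (y : ↥(commFilt k (TensorAlgebra k V) m))
          (z : ↥(commFilt k (TensorAlgebra k V) (n + m + 1))),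
        (z : TensorAlgebra k V) =
            (x : TensorAlgebra k V) * y - (y : TensorAlgebra k V) * x →
          Φ (n + m + 1) (Submodule.Quotient.mk z) =
            pb.bracket (Φ n (Submodule.Quotient.mk x))
              (Φ m (Submodule.Quotient.mk y))) := by
  obtain ⟨ψ, ⟨hψ, hι0⟩, -⟩ := hP (GrQ k (TensorAlgebra k V))
    (grPoisson k (TensorAlgebra k V))
    ((grCls k (TensorAlgebra k V) 0).comp
      ((TensorAlgebra.ι k).codRestrict _ (fun v => by rw [commFilt_zero']; trivial)))
  have hι : ∀ (v : V) (x : commFilt k (TensorAlgebra k V) 0), x.1 = TensorAlgebra.ι k v →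
      ψ (ιP v) = grCls k _ 0 x := by
    intro v x hx
    have h := LinearMap.congr_fun hι0 v
    refine h.trans ?_
    rw [LinearMap.comp_apply]
    congr 1
    exact Subtype.ext hx.symm
  have hinj := psi_injective k V P pb ιP (lieAdj_eq_top k V P pb ιP hP) ψ hψ hι
  obtain ⟨χ, hχ'⟩ := exists_left_inv k P _ ψ hinj
  have honto := psi_onto k V P pb ιP ψ hψ hι
  let Φ : ∀ n : ℕ, grTV k V n →ₗ[k] P := fun n =>
    Submodule.liftQ _ (χ.comp (grCls k (TensorAlgebra k V) n)) (by
      intro x hx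
      rw [LinearMap.mem_ker, LinearMap.comp_apply, (grCls_eq_zero k _ n x).2 hx, map_zero])
  have hΦ : ∀ n x a, ψ a = grCls k _ n x → Φ n (Submodule.Quotient.mk x) = a := by
    intro n x a h
    change χ (grCls k _ n x) = a
    rw [← h, hχ']
  refine ⟨Φ, ?_, ?_, ?_, ?_, ?_⟩
  · intro n
    rw [injective_iff_map_eq_zero]
    intro q hq
    obtain ⟨x, rfl⟩ := Submodule.Quotient.mk_surjective _ q
    obtain ⟨a, -, ha⟩ := honto n x
    rw [hΦ n x a ha] at hq
    rw [hq, map_zero] at ha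
    rw [Submodule.Quotient.mk_eq_zero]
    exact (grCls_eq_zero k _ n x).1 ha.symm
  · intro n
    apply le_antisymm
    · rintro _ ⟨q, rfl⟩
      obtain ⟨x, rfl⟩ := Submodule.Quotient.mk_surjective _ q
      obtain ⟨a, ha', ha⟩ := honto n x
      rwa [hΦ n x a ha]
    · intro a ha
      obtain ⟨x, hx⟩ := psi_homog k V P pb ιP ψ hψ hι n a ha
      exact ⟨Submodule.Quotient.mk x, hΦ n x a hx⟩
  · intro v x hx
    exact hΦ 0 x _ (hι v x hx)
  · intro n m x y z hz
    obtain ⟨a, -, ha⟩ := honto n x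
    obtain ⟨b, -, hb⟩ := honto m y
    rw [hΦ n x a ha, hΦ m y b hb]
    refine hΦ _ z _ ?_
    rw [map_mul, ha, hb, grCls_mul k _ n m x y z hz]
  · intro n m x y z hz
    obtain ⟨a, -, ha⟩ := honto n x
    obtain ⟨b, -, hb⟩ := honto m y
    rw [hΦ n x a ha, hΦ m y b hb]
    refine hΦ _ z _ ?_
    rw [hψ, ha, hb, grCls_br k _ n m x y z hz]
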